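/- Let w be a permutation and let p < q and p' < q' be positive integers with {p,q} ∩ {p',q'} = ∅. Suppose ℓ(wt_{p'q'}) = ℓ(w)+1 and ℓ(wt_{p'q'}t_{pq}) = ℓ(wt_{p'q'})+1. Then m_{pq}(wt_{p'q'}) = m_{pq}(w), m'_{qp}(wt_{p'q'}) = m'_{qp}(w), and ℓ(wt_{pq}) = ℓ(w)+1. -/

import Mathlib

open scoped Classical

noncomputable section

/-- Permutations of the positive integers. -/
abbrev PPerm := Equiv.Perm ℕ+

/-- A permutation fixes all but finitely many points. -/
def HasFinSupp (w : PPerm) : Prop := {k : ℕ+ | w k ≠ k}.Finite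

/-- The transposition `t_{pq}`. -/
def tr (p q : ℕ+) : PPerm := Equiv.swap p q

/-- The set of inversions `I(w)`. -/
def invSet (w : PPerm) : Set (ℕ+ × ℕ+) := {x | x.1 < x.2 ∧ w x.2 < w x.1}

/-- The length `ℓ(w)` (number of inversions). -/
def len (w : PPerm) : ℕ := (invSet w).ncard

/-- `m_{pq}(z) = #{r > q : z(p) < z(r) < z(q)}`. -/
def mCnt (z : PPerm) (p q : ℕ+) : ℕ := {r : ℕ+ | q < r ∧ z p < z r ∧ z r < z q}.ncard

/-- `m'_{qp}(z) = #{r < p : z(p) < z(r) < z(q)}`. -/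
def m'Cnt (z : PPerm) (q p : ℕ+) : ℕ := {r : ℕ+ | r < p ∧ z p < z r ∧ z r < z q}.ncard

/-- The list of transpositions `t_{p₁q₁}, …, t_{p_dq_d}`. -/
def trList (d : ℕ) (p q : Fin d → ℕ+) : List PPerm := List.ofFn fun j => tr (p j) (q j)

/-- `w_{j+1} = w t_{p₁q₁} ⋯ t_{p_jq_j}` (so `wSeq w d p q 0 = w₁ = w`). -/
def wSeq (w : PPerm) (d : ℕ) (p q : Fin d → ℕ+) (j : ℕ) : PPerm :=
  w * ((trList d p q).take j).prod

/-- The defining conditions on a factorization for membership in `X_{i,d}(w)`. -/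
def IsXFact (w : PPerm) (i d : ℕ) (p q : Fin d → ℕ+) : Prop :=
  (∀ j, (p j : ℕ) ≤ i ∧ i < (q j : ℕ)) ∧
  (∀ j : Fin d, len (wSeq w d p q (j + 1)) = len (wSeq w d p q j) + 1) ∧
  (∀ j k : Fin d, j < k → wSeq w d p q j (p j) < wSeq w d p q k (p k))

/-- The defining conditions on a factorization for membership in `Y_{i,d}(w)`. -/
def IsYFact (w : PPerm) (i d : ℕ) (p q : Fin d → ℕ+) : Prop :=
  (∀ j, (p j : ℕ) ≤ i ∧ i < (q j : ℕ)) ∧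
  (∀ j : Fin d, len (wSeq w d p q (j + 1)) = len (wSeq w d p q j) + 1) ∧
  (∀ j k : Fin d, j < k → wSeq w d p q k (q k) < wSeq w d p q j (q j))

/-- The set `X_{i,d}(w)`. -/
def XSet (w : PPerm) (i d : ℕ) : Set PPerm :=
  {ζ | ∃ p q : Fin d → ℕ+, ζ = (trList d p q).prod ∧ IsXFact w i d p q}

/-- The set `Y_{i,d}(w)`. -/
def YSet (w : PPerm) (i d : ℕ) : Set PPerm :=
  {ζ | ∃ p q : Fin d → ℕ+, ζ = (trList d p q).prod ∧ IsYFact w i d p q}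

/-- `w ∈ S^{(n)}`, i.e. `w(n+1) < w(n+2) < ⋯`. -/
def InSn (n : ℕ) (w : PPerm) : Prop := ∀ k l : ℕ+, (n : ℕ) < (k : ℕ) → k < l → w k < w l

/-- `x₁^{m-1} x₂^{m-2} ⋯ x_{m-1}`, the Schubert polynomial of the longest element of `S_m`. -/
def schubBase (m : ℕ) : MvPolynomial ℕ+ ℤ :=
  ∏ k ∈ Finset.range m, MvPolynomial.X (k.succPNat) ^ (m - 1 - k)

/-- The defining property of the family of Schubert polynomials `w ↦ 𝔖_w`:
the value on dominant "staircase" permutations, together with the divided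
difference recursion `𝔖_{w s_i} = ∂_i 𝔖_w` whenever `ℓ(w s_i) < ℓ(w)`, stated
in the product form `(x_i - x_{i+1}) · 𝔖_{w s_i} = 𝔖_w - s_i 𝔖_w`. -/
def IsSchubertFamily (S : PPerm → MvPolynomial ℕ+ ℤ) : Prop :=
  (∀ m : ℕ, ∀ w : PPerm, (∀ k : ℕ+, (k : ℕ) ≤ m → (w k : ℕ) = m + 1 - (k : ℕ)) →
      (∀ k : ℕ+, m < (k : ℕ) → w k = k) → S w = schubBase m) ∧
  (∀ w : PPerm, ∀ i : ℕ+, len (w * tr i (i + 1)) < len w →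
      (MvPolynomial.X i - MvPolynomial.X (i + 1)) * S (w * tr i (i + 1)) =
        S w - MvPolynomial.rename (Equiv.swap i (i + 1)) (S w))

/-- The complete homogeneous symmetric polynomial `h_d(x₁, …, x_i)`. -/
def hPoly (i d : ℕ) : MvPolynomial ℕ+ ℤ :=
  ∑ m : Sym (Fin i) d, ((m : Multiset (Fin i)).map fun k => MvPolynomial.X (k.val.succPNat)).prod

/-- The elementary symmetric polynomial `e_d(x₁, …, x_i)`. -/
def ePoly (i d : ℕ) : MvPolynomial ℕ+ ℤ :=
  ∑ s ∈ Finset.powersetCard d (Finset.univ : Finset (Fin i)),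
    ∏ k ∈ s, MvPolynomial.X (k.val.succPNat)

/-- Lexicographic order on permutations. -/
def lexLT (u v : PPerm) : Prop := ∃ k : ℕ+, (∀ l, l < k → u l = v l) ∧ u k < v k

/-- Reverse lexicographic order on permutations. -/
def rlexLT (u v : PPerm) : Prop := ∃ k : ℕ+, (∀ l, k < l → u l = v l) ∧ u k < v k


lemma HasFinSupp.finite_invSet {w : PPerm} (hw : HasFinSupp w) : (invSet w).Finite := by
  obtain ⟨N, hN⟩ := hw.bddAbove
  have hfix : ∀ k, N < k → w k = k := fun k hk => by
    by_contra h
    exact absurd (hN h) (not_le.mpr hk)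
  refine ((Set.finite_Iic N).prod (Set.finite_Iic N)).subset ?_
  rintro ⟨i, j⟩ ⟨hij, hw'⟩
  dsimp only at hij hw'
  have hj : j ≤ N := by
    by_contra! h
    rw [hfix j h] at hw'
    have := w.injective (hfix (w i) (h.trans hw'))
    order
  exact ⟨hij.le.trans hj, hj⟩

lemma HasFinSupp.mul_tr {w : PPerm} (hw : HasFinSupp w) (p q : ℕ+) :
    HasFinSupp (w * tr p q) := by
  refine (hw.union (Set.toFinite {p, q})).subset ?_
  intro k hk
  by_contra h
  simp only [Set.mem_union, Set.mem_ofPred_eq, Set.mem_insert_iff, Set.mem_singleton_iff,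
    not_or, not_not] at h
  apply hk
  simp [tr, Equiv.swap_apply_of_ne_of_ne h.2.1 h.2.2, h.1]

/-- Apply `t_{pq}` to both entries of a pair, if the result is still increasing. -/
def pairSwap (p q : ℕ+) (x : ℕ+ × ℕ+) : ℕ+ × ℕ+ :=
  if tr p q x.1 < tr p q x.2 then (tr p q x.1, tr p q x.2) else x

lemma pairSwap_pairSwap (p q : ℕ+) {x : ℕ+ × ℕ+} (hx : x.1 < x.2) :
    pairSwap p q (pairSwap p q x) = x := by
  by_cases h : tr p q x.1 < tr p q x.2 <;> simp [pairSwap, h]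
  simp [tr, hx]

lemma ncard_image_pairSwap (w : PPerm) (p q : ℕ+) :
    (pairSwap p q '' invSet w).ncard = len w :=
  (Set.LeftInvOn.injOn (f₁' := pairSwap p q)
    fun _ hx => pairSwap_pairSwap p q hx.1).ncard_image

lemma tr_apply (p q k : ℕ+) : tr p q k = if k = p then q else if k = q then p else k :=
  Equiv.swap_apply_def p q k

lemma invSet_mul_tr {w : PPerm} {p q : ℕ+} (hpq : p < q) (hw : w p < w q) :
    invSet (w * tr p q) = insert (p, q) (pairSwap p q '' invSet w ∪
      {x | ∃ r, p < r ∧ r < q ∧ w p < w r ∧ w r < w q ∧ (x = (p, r) ∨ x = (r, q))}) := by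
  have hne : ∀ a b, w a = w b → a = b := fun a b h => w.injective h
  ext ⟨i, j⟩
  constructor
  · rintro ⟨hij, hinv⟩
    simp only [Equiv.Perm.mul_apply] at hij hinv
    rw [Set.mem_insert_iff, Set.mem_union, or_iff_not_imp_left, or_iff_not_imp_right]
    intro h1 h2
    refine ⟨pairSwap p q (i, j), ?_, pairSwap_pairSwap p q hij⟩
    simp only [Set.mem_ofPred_eq, not_exists, Prod.mk.injEq] at h1 h2
    have hi := h2 i
    have hj := h2 j
    have hip := hne i p
    have hiq := hne i q
    have hjp := hne j p
    have hjq := hne j q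
    clear hne h2
    by_cases hlt : tr p q i < tr p q j
    · rw [pairSwap, if_pos hlt]
      exact ⟨hlt, hinv⟩
    · rw [pairSwap, if_neg hlt]
      refine ⟨hij, ?_⟩
      simp only [tr_apply] at *
      grind (splits := 30)
  · intro h
    rcases h with h | ⟨x, ⟨hx, hinv⟩, h⟩ | ⟨r, h1, h2, h3, h4, h⟩
    · obtain ⟨rfl, rfl⟩ := Prod.mk.inj h
      simp [invSet, tr, hpq, hw]
    · obtain ⟨a, b⟩ := x
      unfold pairSwap at h
      simp only [invSet, Set.mem_ofPred_eq, Equiv.Perm.mul_apply]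
      simp only [tr_apply] at *
      grind
    · simp only [invSet, Set.mem_ofPred_eq, Equiv.Perm.mul_apply]
      simp only [tr_apply]
      grind

lemma notMem_image_pairSwap {w : PPerm} {p q : ℕ+} (hpq : p < q) (hw : w p < w q) {r : ℕ+}
    (hr : p < r) (hrq : r ≤ q) (hwr : w p < w r) : (p, r) ∉ pairSwap p q '' invSet w := by
  rintro ⟨⟨a, b⟩, ⟨hx, hinv⟩, h⟩
  unfold pairSwap at h
  simp only [tr_apply] at *
  grind

lemma len_mul_tr_eq_add_one {w : PPerm} (hwf : HasFinSupp w) {p q : ℕ+} (hpq : p < q)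
    (hw : w p < w q) (hr : ∀ r, p < r → r < q → w p < w r → ¬ w r < w q) :
    len (w * tr p q) = len w + 1 := by
  have h : {x : ℕ+ × ℕ+ | ∃ r, p < r ∧ r < q ∧ w p < w r ∧ w r < w q ∧
      (x = (p, r) ∨ x = (r, q))} = ∅ := by
    ext x
    simp only [Set.mem_ofPred_eq, Set.mem_empty_iff_false, iff_false]
    rintro ⟨r, h1, h2, h3, h4, -⟩
    exact hr r h1 h2 h3 h4
  rw [len, invSet_mul_tr hpq hw, h, Set.union_empty,
    Set.ncard_insert_of_notMem (notMem_image_pairSwap hpq hw hpq le_rfl hw)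
      (hwf.finite_invSet.image _), ncard_image_pairSwap]

lemma len_lt_len_mul_tr {w : PPerm} (hwf : HasFinSupp w) {p q : ℕ+} (hpq : p < q)
    (hw : w p < w q) : len w < len (w * tr p q) := by
  rw [← ncard_image_pairSwap w p q, len]
  refine Set.ncard_lt_ncard ?_ (hwf.mul_tr p q).finite_invSet
  rw [invSet_mul_tr hpq hw, Set.ssubset_iff_exists]
  exact ⟨Set.subset_union_left.trans (Set.subset_insert _ _), (p, q), Set.mem_insert _ _,
    notMem_image_pairSwap hpq hw hpq le_rfl hw⟩

lemma len_mul_tr_eq_add_one_iff {w : PPerm} (hwf : HasFinSupp w) {p q : ℕ+} (hpq : p < q) :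
    len (w * tr p q) = len w + 1 ↔
      w p < w q ∧ ∀ r, p < r → r < q → w p < w r → ¬ w r < w q := by
  refine ⟨fun h => ?_, fun h => len_mul_tr_eq_add_one hwf hpq h.1 h.2⟩
  have hw : w p < w q := by
    refine lt_of_not_ge fun hle => ?_
    have hlt := len_lt_len_mul_tr (hwf.mul_tr p q) hpq
      (by simpa [tr] using lt_of_le_of_ne hle (w.injective.ne hpq.ne'))
    rw [mul_assoc, tr, Equiv.swap_mul_self, mul_one] at hlt
    rw [tr] at h
    omega
  refine ⟨hw, fun r h1 h2 h3 h4 => ?_⟩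
  have hfin := hwf.finite_invSet.image (pairSwap p q)
  have hsub : insert (p, q) (insert (p, r) (pairSwap p q '' invSet w)) ⊆
      invSet (w * tr p q) := by
    rw [invSet_mul_tr hpq hw]
    refine Set.insert_subset_insert (Set.insert_subset ?_ Set.subset_union_left)
    exact Or.inr ⟨r, h1, h2, h3, h4, Or.inl rfl⟩
  have hcard := Set.ncard_le_ncard hsub (hwf.mul_tr p q).finite_invSet
  rw [Set.ncard_insert_of_notMem _ (hfin.insert _), Set.ncard_insert_of_notMem
    (notMem_image_pairSwap hpq hw h1 h2.le h3) hfin, ncard_image_pairSwap] at hcard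
  · rw [len] at h
    omega
  · rw [Set.mem_insert_iff, not_or]
    exact ⟨by simp [h2.ne'], notMem_image_pairSwap hpq hw hpq le_rfl hw⟩

/-- Precomposing with a transposition preserves the cardinality of a set of positions with values
in a given interval, provided membership of the two exchanged points is balanced. -/
lemma ncard_mul_tr_eq {w : PPerm} {p q a b : ℕ+} {P : ℕ+ → Prop}
    (h : (P p ↔ P q) ∨ ((a < w p ∧ w p < b) ↔ (a < w q ∧ w q < b))) :
    {r | P r ∧ a < (w * tr p q) r ∧ (w * tr p q) r < b}.ncard =
      {r | P r ∧ a < w r ∧ w r < b}.ncard := by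
  rcases h with h | h
  · have hP : ∀ r, P (tr p q r) ↔ P r := by
      intro r
      rw [tr_apply]
      grind
    have hinv : ∀ r, tr p q (tr p q r) = r := Equiv.swap_apply_self p q
    rw [← Set.ncard_image_of_injective _ (tr p q).injective]
    congr 1
    ext r
    constructor
    · rintro ⟨x, ⟨hx, hxw⟩, rfl⟩
      exact ⟨(hP x).2 hx, hxw⟩
    · rintro ⟨hr, hrw⟩
      refine ⟨tr p q r, ⟨(hP r).2 hr, ?_⟩, hinv r⟩
      rwa [Equiv.Perm.mul_apply, hinv]
  · congr 1
    ext r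
    simp only [Set.mem_ofPred_eq, Equiv.Perm.mul_apply, tr_apply]
    grind

/-- If `{p,q} ∩ {p',q'} = ∅` and `w t_{p'q'} t_{pq} ⋗ w t_{p'q'} ⋗ w`, then
`m_{pq}(w t_{p'q'}) = m_{pq}(w)`, `m'_{qp}(w t_{p'q'}) = m'_{qp}(w)` and `w t_{pq} ⋗ w`. -/
theorem m_invariance_disjoint (w : PPerm) (hwf : HasFinSupp w) (p q p' q' : ℕ+)
    (hpq : p < q) (hp'q' : p' < q')
    (hdisj : ({p, q} ∩ {p', q'} : Set ℕ+) = ∅)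
    (h1 : len (w * tr p' q') = len w + 1)
    (h2 : len (w * tr p' q' * tr p q) = len (w * tr p' q') + 1) :
    mCnt (w * tr p' q') p q = mCnt w p q ∧
      m'Cnt (w * tr p' q') q p = m'Cnt w q p ∧
      len (w * tr p q) = len w + 1 := by
  obtain ⟨⟨hpp, hpq'⟩, hqp, hqq⟩ : (p ≠ p' ∧ p ≠ q') ∧ q ≠ p' ∧ q ≠ q' := by
    simpa [Set.eq_empty_iff_forall_notMem] using hdisj
  rw [len_mul_tr_eq_add_one_iff hwf hp'q'] at h1
  rw [len_mul_tr_eq_add_one_iff (hwf.mul_tr _ _) hpq] at h2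
  rw [len_mul_tr_eq_add_one_iff hwf hpq]
  have hp : tr p' q' p = p := Equiv.swap_apply_of_ne_of_ne hpp hpq'
  have hq : tr p' q' q = q := Equiv.swap_apply_of_ne_of_ne hqp hqq
  have hp' : tr p' q' p' = q' := Equiv.swap_apply_left _ _
  have hq' : tr p' q' q' = p' := Equiv.swap_apply_right _ _
  have := hpp.lt_or_gt
  have := (w.injective.ne hpp).lt_or_gt
  have := hpq'.lt_or_gt
  have := (w.injective.ne hpq').lt_or_gt
  have := hqp.lt_or_gt
  have := (w.injective.ne hqp).lt_or_gt
  have := hqq.lt_or_gt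
  have := (w.injective.ne hqq).lt_or_gt
  simp only [mCnt, m'Cnt, Equiv.Perm.mul_apply, hp, hq] at h2 ⊢
  obtain ⟨h1, h1'⟩ := h1
  obtain ⟨h2, h2'⟩ := h2
  have e1 := h1' p
  have e2 := h1' q
  have e3 := h2' p'
  have e4 := h2' q'
  rw [hp'] at e3
  rw [hq'] at e4
  refine ⟨ncard_mul_tr_eq (P := (q < ·)) ?_, ncard_mul_tr_eq (P := (· < p)) ?_, h2, ?_⟩
  · clear h1' h2' hdisj
    grind (splits := 30)
  · clear h1' h2' hdisj
    grind (splits := 30)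
  · intro r hr1 hr2
    have e5 := h2' r hr1 hr2
    rw [tr_apply] at e5
    grind

end
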